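/- Suppose (μ, m) has critical root structure with roots 0 < t_1 < … < t_k < 1 of orders v_1, …, v_k, and set v = max_{1 ≤ l ≤ k} v_l. Let σ : [0,1] → ℝ be Lipschitz continuous, let K : ℝ → ℝ be continuous and even with support contained in [−1,1], and let K_d : ℝ → ℝ be continuous and even with support contained in [−1,1]. Let (b_n) and (h_n) be positive sequences with b_n → 0, n·b_n → ∞, h_n → 0 and b_n^{v+1}/h_n → ∞. Define α_n = (1/(n²·b_n²·h_n²)) · Σ_{j=1}^{n} ( ∫_0^1 σ(j/n)·K((t − j/n)/b_n)·K_d((μ(t) − m)/h_n) dt )². Then lim_{n → ∞} n·b_n·h_n^{2v/(v+1)} · α_n = ((v+1)!)^{2/(v+1)} · (∫_{−1}^{1} K_d(z^{v+1}) dz)² · (∫_{−1}^{1} K(x)² dx) · Σ_{l : v_l = v} σ(t_l)² / |μ^{(v_l+1)}(t_l)|^{2/(v+1)}. -/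

import Mathlib

open MeasureTheory Set

/-- The extended root sequence: `t₀ = 0`, `t_{k+1} = 1`, and the given roots in between. -/
noncomputable def extRoots (k : ℕ) (t : ℕ → ℝ) : ℕ → ℝ :=
  fun i => if i = 0 then 0 else if i ≤ k then t i else 1

/-- `(μ, m)` has critical root structure with roots `0 < t 1 < … < t k < 1` of orders
`v 1, …, v k` and gap parameter `γ = (1/2)·min_{0 ≤ i ≤ k} (t_{i+1} - t_i)`
(with the convention `t 0 = 0`, `t (k+1) = 1`). -/
structure CriticalRootStructure (μ : ℝ → ℝ) (m : ℝ) (k : ℕ) (t : ℕ → ℝ)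
    (v : ℕ → ℕ) (γ : ℝ) : Prop where
  k_pos : 0 < k
  mono : ∀ i j, 1 ≤ i → i < j → j ≤ k → t i < t j
  first_pos : 0 < t 1
  last_lt : t k < 1
  gamma_eq : γ = (1 / 2) * ((Finset.Icc 0 k).inf' (Finset.nonempty_Icc.mpr (Nat.zero_le k))
      fun i => extRoots k t (i + 1) - extRoots k t i)
  root : ∀ l, 1 ≤ l → l ≤ k → μ (t l) = m
  -- (i) μ is (v l + 1)-times differentiable on [t l - γ, t l + γ] ...
  diffble : ∀ l, 1 ≤ l → l ≤ k → ∀ j ≤ v l,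
      DifferentiableOn ℝ (iteratedDerivWithin j μ (Icc (t l - γ) (t l + γ)))
        (Icc (t l - γ) (t l + γ))
  -- ... with μ^{(j)}(t l) = 0 for 1 ≤ j ≤ v l ...
  deriv_zero : ∀ l, 1 ≤ l → l ≤ k → ∀ j, 1 ≤ j → j ≤ v l →
      iteratedDerivWithin j μ (Icc (t l - γ) (t l + γ)) (t l) = 0
  -- ... μ^{(v l + 1)}(t l) ≠ 0 ...
  deriv_ne : ∀ l, 1 ≤ l → l ≤ k →
      iteratedDerivWithin (v l + 1) μ (Icc (t l - γ) (t l + γ)) (t l) ≠ 0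
  -- ... and μ^{(v l + 1)} Lipschitz continuous on [t l - γ, t l + γ].
  deriv_lip : ∀ l, 1 ≤ l → l ≤ k → ∃ C : NNReal,
      LipschitzOnWith C (iteratedDerivWithin (v l + 1) μ (Icc (t l - γ) (t l + γ)))
        (Icc (t l - γ) (t l + γ))
  -- (ii) μ strictly monotone on [t l - γ, t l] and on [t l, t l + γ].
  mono_left : ∀ l, 1 ≤ l → l ≤ k →
      StrictMonoOn μ (Icc (t l - γ) (t l)) ∨ StrictAntiOn μ (Icc (t l - γ) (t l))
  mono_right : ∀ l, 1 ≤ l → l ≤ k →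
      StrictMonoOn μ (Icc (t l) (t l + γ)) ∨ StrictAntiOn μ (Icc (t l) (t l + γ))
  -- (iii) |μ - m| bounded away from 0 outside the γ-neighbourhoods of the roots.
  sep : ∃ ε > 0, ∀ s ∈ Icc (0:ℝ) 1,
      (∀ l, 1 ≤ l → l ≤ k → γ < |s - t l|) → ε ≤ |μ s - m|

open Filter Topology

section LocalExpansion

variable {μ : ℝ → ℝ} {m t γ : ℝ} {N : ℕ}

/-- At a point where the first `v` derivatives vanish, `μ - μ t` is of exact order `v + 1`. -/
lemma tendsto_sub_div_pow_of_iteratedDerivWithin_eq_zero {v : ℕ} (hγ : 0 < γ)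
    (hμ : ContDiffOn ℝ (v + 1 : ℕ) μ (Icc (t - γ) (t + γ))) (hm : μ t = m)
    (hz : ∀ j, 1 ≤ j → j ≤ v → iteratedDerivWithin j μ (Icc (t - γ) (t + γ)) t = 0) :
    Tendsto (fun x => (μ x - m) / (x - t) ^ (v + 1)) (𝓝[≠] t)
      (𝓝 (iteratedDerivWithin (v + 1) μ (Icc (t - γ) (t + γ)) t / (v + 1).factorial)) := by
  have hmem : t ∈ Icc (t - γ) (t + γ) := ⟨by linarith, by linarith⟩
  have hnhds : Icc (t - γ) (t + γ) ∈ 𝓝 t := Icc_mem_nhds (by linarith) (by linarith)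
  have hT := taylor_tendsto (convex_Icc _ _) hmem hμ
  rw [nhdsWithin_eq_nhds.mpr hnhds] at hT
  have hT' := (hT.mono_left (nhdsWithin_le_nhds (s := {t}ᶜ))).add_const
    (iteratedDerivWithin (v + 1) μ (Icc (t - γ) (t + γ)) t / (v + 1).factorial)
  rw [zero_add] at hT'
  refine hT'.congr' ?_
  filter_upwards [self_mem_nhdsWithin] with x hx
  have hx0 : x - t ≠ 0 := sub_ne_zero.mpr hx
  have hlow : taylorWithinEval μ v (Icc (t - γ) (t + γ)) t x = m := by
    rw [taylor_within_apply, Finset.sum_eq_single_of_mem 0 (by simp)]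
    · simp [hm]
    · intro j hj hj0
      rw [hz j (by omega) (by simpa [Nat.lt_succ_iff] using hj), smul_zero]
  rw [taylorWithinEval_succ, hlow, Nat.factorial_succ]
  have hf : (v.factorial : ℝ) ≠ 0 := by positivity
  have hv : (v + 1 : ℝ) ≠ 0 := by positivity
  push_cast
  simp only [smul_eq_mul]
  field_simp
  ring

/-- A quantitative lower bound for a function with a single zero of order `N`. -/
lemma exists_mul_pow_le_abs_sub {a : ℝ} (hγ : 0 < γ)
    (hμ : ContinuousOn μ (Icc (t - γ) (t + γ))) (ha : a ≠ 0)
    (hne : ∀ x ∈ Icc (t - γ) (t + γ), x ≠ t → μ x ≠ m)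
    (hlim : Tendsto (fun x => (μ x - m) / (x - t) ^ N) (𝓝[≠] t) (𝓝 a)) :
    ∃ κ > 0, ∀ x ∈ Icc (t - γ) (t + γ), x ≠ t → κ * |x - t| ^ N ≤ |μ x - m| := by
  classical
  set q := Function.update (fun x => (μ x - m) / (x - t) ^ N) t a with hq
  have hmem : t ∈ Icc (t - γ) (t + γ) := ⟨by linarith, by linarith⟩
  have hqc : ContinuousOn q (Icc (t - γ) (t + γ)) := by
    rw [hq, continuousOn_update_iff]
    refine ⟨?_, fun _ => hlim.mono_left (nhdsWithin_mono _ fun x hx => hx.2)⟩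
    refine ((hμ.mono sdiff_subset).sub continuousOn_const).div (by fun_prop) ?_
    intro x hx
    exact pow_ne_zero _ (sub_ne_zero.mpr hx.2)
  obtain ⟨x₀, hx₀, hmin⟩ := isCompact_Icc.exists_isMinOn ⟨t, hmem⟩ hqc.abs
  refine ⟨|q x₀|, ?_, fun x hx hxt => ?_⟩
  · rw [gt_iff_lt, abs_pos, hq]
    by_cases h : x₀ = t
    · subst h; simpa using ha
    · rw [Function.update_of_ne h]
      exact div_ne_zero (sub_ne_zero.mpr (hne x₀ hx₀ h)) (pow_ne_zero _ (sub_ne_zero.mpr h))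
  · have h1 : |q x₀| ≤ |q x| := hmin hx
    have h2 : q x = (μ x - m) / (x - t) ^ N := by rw [hq, Function.update_of_ne hxt]
    have hpos : 0 < |x - t| ^ N := pow_pos (abs_pos.mpr (sub_ne_zero.mpr hxt)) _
    rwa [h2, abs_div, abs_pow, le_div_iff₀ hpos] at h1

end LocalExpansion

section Kernel

variable {K : ℝ → ℝ}

lemma eq_zero_of_one_lt_abs (hs : Function.support K ⊆ Icc (-1 : ℝ) 1) {x : ℝ} (hx : 1 < |x|) :
    K x = 0 := by
  by_contra h
  exact absurd (abs_le.mpr (hs h)) (not_le.mpr hx)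

lemma hasCompactSupport_of_support_subset_Icc (hs : Function.support K ⊆ Icc (-1 : ℝ) 1) :
    HasCompactSupport K :=
  HasCompactSupport.of_support_subset_isCompact isCompact_Icc hs

lemma exists_pos_bound_of_support_subset_Icc (hc : Continuous K)
    (hs : Function.support K ⊆ Icc (-1 : ℝ) 1) : ∃ B > 0, ∀ x, |K x| ≤ B := by
  obtain ⟨B, hB⟩ := (hasCompactSupport_of_support_subset_Icc hs).exists_bound_of_continuous hc
  exact ⟨max B 1, by positivity, fun x => (hB x).trans (le_max_left _ _)⟩

lemma intervalIntegral_eq_setIntegral_of_support_subset_Icc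
    (hs : Function.support K ⊆ Icc (-1 : ℝ) 1) {p q : ℝ} (hp : p < -1) (hq : 1 ≤ q) :
    ∫ x in p..q, K x = ∫ x in Icc (-1 : ℝ) 1, K x := by
  rw [intervalIntegral.integral_of_le (by linarith)]
  refine setIntegral_eq_of_subset_of_forall_sdiff_eq_zero measurableSet_Ioc
    (fun x hx => ⟨by linarith [hx.1], by linarith [hx.2]⟩) fun x hx => ?_
  by_contra h
  exact hx.2 (hs h)

/-- Substitution removing the leading coefficient `a` from `∫ K (a z ^ V)`. -/
lemma integral_comp_const_mul_pow (he : ∀ x, K (-x) = K x)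
    (hs : Function.support K ⊆ Icc (-1 : ℝ) 1) {a M : ℝ} {V : ℕ} (hV : 0 < V) (ha : a ≠ 0)
    (hM : 1 ≤ M) (haM : 1 < |a| * M) :
    ∫ z in (-M)..M, K (a * z ^ V) =
      (|a| ^ (1 / (V : ℝ)))⁻¹ * ∫ z in Icc (-1 : ℝ) 1, K (z ^ V) := by
  set s := |a| ^ (1 / (V : ℝ)) with hsdef
  have hspos : 0 < s := Real.rpow_pos_of_pos (abs_pos.mpr ha) _
  have hsV : s ^ V = |a| := by
    rw [hsdef, one_div, Real.rpow_inv_natCast_pow (abs_nonneg a) hV.ne']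
  have hsM : 1 < s * M := by
    by_contra! h
    have h1 : (s * M) ^ V ≤ 1 := pow_le_one₀ (by positivity) h
    rw [mul_pow, hsV] at h1
    have h2 : M ≤ M ^ V := le_self_pow₀ hM hV.ne'
    nlinarith [abs_nonneg a]
  have hcongr : ∀ z, K (a * z ^ V) = K ((s * z) ^ V) := by
    intro z
    rw [mul_pow, hsV]
    rcases abs_choice a with h | h <;> rw [h]
    rw [neg_mul, he]
  simp_rw [hcongr]
  rw [intervalIntegral.integral_comp_mul_left (fun z => K (z ^ V)) hspos.ne', smul_eq_mul]
  congr 1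
  refine intervalIntegral_eq_setIntegral_of_support_subset_Icc (K := fun z => K (z ^ V))
    (fun z hz => ?_) (by linarith) hsM.le
  by_contra h
  rw [mem_Icc, ← abs_le, not_le] at h
  refine hz (eq_zero_of_one_lt_abs hs ?_)
  rw [abs_pow]
  exact one_lt_pow₀ h hV.ne'

/-- Away from the root, on the scale `ρ`, the localizing kernel vanishes. -/
lemma kernel_eq_zero_of_lt_abs_sub (hs : Function.support K ⊆ Icc (-1 : ℝ) 1)
    {μ : ℝ → ℝ} {m t κ M ρ x : ℝ} {N V : ℕ} (hN : 0 < N) (hNV : N ≤ V) (hκ : 0 < κ)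
    (hM : 1 ≤ M) (hκM : 1 ≤ κ * M) (hρ : 0 < ρ) (hρ1 : ρ ≤ 1)
    (hlow : x ≠ t → κ * |x - t| ^ N ≤ |μ x - m|) (hx : M * ρ < |x - t|) :
    K ((μ x - m) / ρ ^ V) = 0 := by
  have hxt : x ≠ t := by
    rintro rfl
    simp only [sub_self, abs_zero] at hx
    nlinarith
  apply eq_zero_of_one_lt_abs hs
  have hρV : 0 < ρ ^ V := pow_pos hρ V
  rw [abs_div, abs_of_pos hρV, one_lt_div hρV]
  calc ρ ^ V ≤ ρ ^ N := pow_le_pow_of_le_one hρ.le hρ1 hNV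
    _ ≤ (κ * M) * ρ ^ N := le_mul_of_one_le_left (by positivity) hκM
    _ ≤ (κ * M ^ N) * ρ ^ N := by gcongr; exact le_self_pow₀ hM hN.ne'
    _ = κ * (M * ρ) ^ N := by ring
    _ < κ * |x - t| ^ N := by gcongr
    _ ≤ |μ x - m| := hlow hxt

/-- Rescaled mass of the localizing kernel near a root of order `N`, on the scale `ρ = h ^ (1/V)`:
only roots of the maximal order `N = V` contribute in the limit. -/
lemma tendsto_inv_mul_integral_kernel (hc : Continuous K)
    (hs : Function.support K ⊆ Icc (-1 : ℝ) 1)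
    {μ : ℝ → ℝ} {m t γ a M : ℝ} {N V : ℕ} (hγ : 0 < γ) (hNV : N ≤ V)
    (hμ : ContinuousOn μ (Icc (t - γ) (t + γ))) (ha : a ≠ 0)
    (hlim : Tendsto (fun x => (μ x - m) / (x - t) ^ N) (𝓝[≠] t) (𝓝 a))
    (hM : 0 < M) {ρ : ℕ → ℝ} (hρ : ∀ n, 0 < ρ n) (hρ0 : Tendsto ρ atTop (𝓝 0)) :
    Tendsto (fun n => (ρ n)⁻¹ * ∫ x in Icc (t - M * ρ n) (t + M * ρ n),
        K ((μ x - m) / ρ n ^ V)) atTop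
      (𝓝 (if N = V then ∫ z in (-M)..M, K (a * z ^ V) else 0)) := by
  obtain ⟨B, hB0, hB⟩ := exists_pos_bound_of_support_subset_Icc hc hs
  have hsmall : ∀ᶠ n in atTop, M * ρ n < γ := by
    have : Tendsto (fun n => M * ρ n) atTop (𝓝 0) := by simpa using hρ0.const_mul M
    exact this.eventually_lt_const hγ
  have hsub : ∀ n, (ρ n)⁻¹ * ∫ x in Icc (t - M * ρ n) (t + M * ρ n), K ((μ x - m) / ρ n ^ V) =
      ∫ z in (-M)..M, K ((μ (t + ρ n * z) - m) / ρ n ^ V) := by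
    intro n
    have hle : t - M * ρ n ≤ t + M * ρ n := by nlinarith [hρ n]
    rw [intervalIntegral.integral_comp_add_mul (fun x => K ((μ x - m) / ρ n ^ V)) (hρ n).ne' t,
      integral_Icc_eq_integral_Ioc, ← intervalIntegral.integral_of_le hle, smul_eq_mul]
    congr 2 <;> ring
  simp_rw [hsub]
  have hval : (if N = V then ∫ z in (-M)..M, K (a * z ^ V) else 0) =
      ∫ z in (-M)..M, (if N = V then K (a * z ^ V) else 0) := by
    split_ifs <;> simp
  rw [hval]
  refine intervalIntegral.tendsto_integral_filter_of_dominated_convergence (fun _ => B) ?_ ?_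
    (by simp) ?_
  · filter_upwards [hsmall] with n hn
    refine ContinuousOn.aestronglyMeasurable ?_ measurableSet_uIoc
    refine hc.comp_continuousOn (ContinuousOn.div_const (ContinuousOn.sub ?_ continuousOn_const) _)
    refine hμ.comp (by fun_prop) fun z hz => ?_
    rw [uIoc_of_le (by linarith)] at hz
    constructor <;> nlinarith [hρ n, hz.1, hz.2]
  · exact Eventually.of_forall fun n => Eventually.of_forall fun z _ => hB _
  · have hne : ∀ᵐ z : ℝ, z ≠ 0 := by
      simp [ae_iff, measure_singleton]
    filter_upwards [hne] with z hz _
    have hx : Tendsto (fun n => t + ρ n * z) atTop (𝓝[≠] t) := by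
      refine tendsto_nhdsWithin_iff.mpr ⟨?_, Eventually.of_forall fun n => ?_⟩
      · simpa using (hρ0.mul_const z).const_add t
      · simpa using ⟨(hρ n).ne', hz⟩
    have hq := hlim.comp hx
    have hform : ∀ n, (μ (t + ρ n * z) - m) / ρ n ^ V =
        ((μ (t + ρ n * z) - m) / (t + ρ n * z - t) ^ N * z ^ N) / ρ n ^ (V - N) := by
      intro n
      have h1 : ρ n ^ V = ρ n ^ N * ρ n ^ (V - N) := by rw [← pow_add, Nat.add_sub_of_le hNV]
      have := (hρ n).ne'
      rw [add_sub_cancel_left, h1, mul_pow]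
      field_simp
    simp_rw [hform]
    have hq' := hq.mul_const (z ^ N)
    split_ifs with hcase
    · subst hcase
      simpa [Function.comp_def] using (hc.tendsto _).comp hq'
    · have hk : V - N ≠ 0 := by omega
      have hlimabs : Tendsto (fun n => |(μ (t + ρ n * z) - m) / (t + ρ n * z - t) ^ N * z ^ N| /
          ρ n ^ (V - N)) atTop atTop := by
        simp_rw [div_eq_mul_inv]
        refine Tendsto.pos_mul_atTop (abs_pos.mpr (mul_ne_zero ha (pow_ne_zero N hz))) hq'.abs ?_
        refine Tendsto.inv_tendsto_nhdsGT_zero (tendsto_nhdsWithin_iff.mpr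
          ⟨by simpa [hk] using hρ0.pow (V - N),
            Eventually.of_forall fun n => pow_pos (hρ n) _⟩)
      refine tendsto_const_nhds.congr' ?_
      filter_upwards [hlimabs.eventually_gt_atTop 1] with n hn
      refine (eq_zero_of_one_lt_abs hs ?_).symm
      rwa [abs_div, abs_of_pos (pow_pos (hρ n) _)]

end Kernel

section Averages

lemma card_filter_abs_div_sub_le {n : ℕ} (hn : 0 < n) (t r : ℝ) (hr : 0 ≤ r) :
    (((Finset.Icc 1 n).filter fun j : ℕ => |(j : ℝ) / n - t| ≤ r).card : ℝ) ≤ 2 * n * r + 1 := by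
  have hn' : (0 : ℝ) < n := by exact_mod_cast hn
  have hcard : ((Finset.Icc 1 n).filter fun j : ℕ => |(j : ℝ) / n - t| ≤ r).card ≤
      (Finset.Icc ⌈n * (t - r)⌉ ⌊n * (t + r)⌋).card := by
    refine Finset.card_le_card_of_injOn (fun j => (j : ℤ)) (fun j hj => ?_)
      (fun i _ j _ h => Int.ofNat_inj.mp h)
    simp only [Finset.coe_filter, mem_ofPred_eq, abs_le] at hj
    have h1 : (j : ℝ) = n * ((j : ℝ) / n) := by field_simp
    simp only [Finset.coe_Icc, mem_Icc, Int.ceil_le, Int.le_floor, Int.cast_natCast]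
    constructor
    · rw [h1]; gcongr; linarith [hj.2.1]
    · rw [h1]; gcongr; linarith [hj.2.2]
  rw [Int.card_Icc] at hcard
  have h2 : ((⌊n * (t + r)⌋ + 1 - ⌈n * (t - r)⌉).toNat : ℝ) ≤ 2 * n * r + 1 := by
    rw [← Int.cast_natCast, Int.toNat_eq_max, Int.cast_max]
    refine max_le ?_ (by push_cast; positivity)
    push_cast
    linarith [Int.floor_le ((n : ℝ) * (t + r)), Int.le_ceil ((n : ℝ) * (t - r))]
  exact (Nat.cast_le.mpr hcard).trans h2

/-- An average over a window of width `O(b)` is controlled by the sup of the summands. -/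
lemma abs_localized_average_le {n : ℕ} {b B t : ℝ} (hb : 0 < b) (hnb : 1 ≤ n * b)
    (hB0 : 0 ≤ B) (Φ : ℕ → ℝ)
    (hB : ∀ j ∈ Finset.Icc 1 n, |Φ j| ≤ B)
    (h0 : ∀ j ∈ Finset.Icc 1 n, 2 * b < |(j : ℝ) / n - t| → Φ j = 0) :
    |1 / (n * b) * ∑ j ∈ Finset.Icc 1 n, Φ j| ≤ 5 * B := by
  have hn : 0 < n := by
    rcases Nat.eq_zero_or_pos n with h | h
    · subst h; norm_num at hnb
    · exact h
  have hsum : ∑ j ∈ Finset.Icc 1 n, Φ j =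
      ∑ j ∈ (Finset.Icc 1 n).filter fun j : ℕ => |(j : ℝ) / n - t| ≤ 2 * b, Φ j := by
    refine (Finset.sum_filter_of_ne fun j hj hne => ?_).symm
    by_contra h
    exact hne (h0 j hj (not_le.mp h))
  have hle : |∑ j ∈ Finset.Icc 1 n, Φ j| ≤ 5 * B * (n * b) := by
    rw [hsum]
    refine (Finset.abs_sum_le_sum_abs _ _).trans ?_
    refine (Finset.sum_le_card_nsmul _ _ B fun j hj => hB j (Finset.mem_filter.mp hj).1).trans ?_
    rw [nsmul_eq_mul]
    have := card_filter_abs_div_sub_le hn t (2 * b) (by positivity)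
    nlinarith
  have hpos : 0 < n * b := by linarith
  rw [abs_mul, abs_of_pos (by positivity), one_div, inv_mul_le_iff₀ hpos]
  linarith

variable {b : ℕ → ℝ} {t : ℝ}

/-- Kernel-weighted Riemann sums at bandwidth `b` with `n b → ∞`. -/
lemma tendsto_riemann_sum_kernel {g : ℝ → ℝ} (hg : Continuous g)
    (hs : Function.support g ⊆ Icc (-1 : ℝ) 1) (ht0 : 0 < t) (ht1 : t < 1)
    (hb : ∀ n, 0 < b n) (hb0 : Tendsto b atTop (𝓝 0))
    (hnb : Tendsto (fun n : ℕ => (n : ℝ) * b n) atTop atTop) :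
    Tendsto (fun n : ℕ => 1 / (n * b n) * ∑ j ∈ Finset.Icc 1 n, g ((t - (j : ℝ) / n) / b n))
      atTop (𝓝 (∫ x in Icc (-1 : ℝ) 1, g x)) := by
  have huc := (hasCompactSupport_of_support_subset_Icc hs).uniformContinuous_of_continuous hg
  rw [Metric.tendsto_nhds]
  intro ε hε
  obtain ⟨δ, hδ, hgδ⟩ := Metric.uniformContinuous_iff.mp huc (ε / 10) (by positivity)
  filter_upwards [hb0.eventually_lt_const ht0, hb0.eventually_lt_const (sub_pos.mpr ht1),
    hnb.eventually_ge_atTop 1, hnb.eventually_gt_atTop (1 / δ)] with n hbt hbt1 hnb1 hnbδ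
  have hbn := hb n
  have hn : (0 : ℝ) < n := by
    by_contra! h
    nlinarith
  have hint : ∫ x in Icc (-1 : ℝ) 1, g x =
      ∑ j ∈ Finset.Icc 1 n, (b n)⁻¹ * ∫ x in ((j : ℝ) - 1) / n..(j : ℝ) / n,
        g ((t - x) / b n) := by
    have hp : (t - 1) / b n < -1 := by rw [div_lt_iff₀ hbn]; linarith
    have hq : 1 ≤ (t - 0) / b n := by rw [le_div_iff₀ hbn]; linarith
    rw [← intervalIntegral_eq_setIntegral_of_support_subset_Icc hs hp hq, ← Finset.mul_sum]
    have hadj := intervalIntegral.sum_integral_adjacent_intervals (n := n)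
      (f := fun x => g ((t - x) / b n)) (a := fun i : ℕ => (i : ℝ) / n) (μ := volume)
      (fun i _ => (Continuous.intervalIntegrable (by fun_prop) _ _))
    have hre : ∑ j ∈ Finset.Icc 1 n, ∫ x in ((j : ℝ) - 1) / n..(j : ℝ) / n, g ((t - x) / b n) =
        ∑ i ∈ Finset.range n, ∫ x in (i : ℝ) / n..((i + 1 : ℕ) : ℝ) / n, g ((t - x) / b n) := by
      have hIcc : Finset.Icc 1 n = Finset.Ico (0 + 1) (n + 1) := by ext; simp
      rw [Finset.range_eq_Ico, hIcc, ← Finset.sum_Ico_add']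
      simp
    rw [hre, hadj]
    have hcv := intervalIntegral.integral_comp_sub_left
      (fun y => g (y / b n)) t (a := 0) (b := 1)
    simp only [Nat.cast_zero, zero_div, div_self hn.ne']
    rw [hcv, intervalIntegral.integral_comp_div g hbn.ne', smul_eq_mul, ← mul_assoc,
      inv_mul_cancel₀ hbn.ne', one_mul]
  have hterm : ∀ j : ℕ, 1 / (n * b n) * g ((t - (j : ℝ) / n) / b n) -
      (b n)⁻¹ * ∫ x in ((j : ℝ) - 1) / n..(j : ℝ) / n, g ((t - x) / b n) =
      1 / (n * b n) * (n * ∫ x in ((j : ℝ) - 1) / n..(j : ℝ) / n,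
        (g ((t - (j : ℝ) / n) / b n) - g ((t - x) / b n))) := by
    intro j
    rw [intervalIntegral.integral_sub (by simp) (Continuous.intervalIntegrable (by fun_prop) _ _),
      intervalIntegral.integral_const, smul_eq_mul]
    field_simp
    ring
  have hle : ∀ j : ℕ, ((j : ℝ) - 1) / n ≤ (j : ℝ) / n := fun j => by gcongr; linarith
  have hnear : ∀ j : ℕ, ∀ x ∈ uIoc (((j : ℝ) - 1) / n) ((j : ℝ) / n),
      |(j : ℝ) / n - x| ≤ 1 / n := by
    intro j x hx
    rw [uIoc_of_le (hle j)] at hx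
    have := hx.1
    rw [sub_div] at this
    rw [abs_of_nonneg (by linarith [hx.2])]
    linarith
  have hnb' : 1 / (n : ℝ) ≤ b n := by rw [div_le_iff₀ hn]; linarith
  rw [Real.dist_eq, hint, Finset.mul_sum, ← Finset.sum_sub_distrib, Finset.sum_congr rfl
    (fun j _ => hterm j), ← Finset.mul_sum]
  refine (abs_localized_average_le (t := t) (B := ε / 10) hbn hnb1 (by positivity) _
    (fun j _ => ?_) fun j _ hj => ?_).trans_lt (by linarith)
  · have := intervalIntegral.norm_integral_le_of_norm_le_const (C := ε / 10)
      (f := fun x => g ((t - (j : ℝ) / n) / b n) - g ((t - x) / b n))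
      (a := ((j : ℝ) - 1) / n) (b := (j : ℝ) / n) (fun x hx => ?_)
    · rw [abs_mul, abs_of_pos hn]
      rw [Real.norm_eq_abs, show (j : ℝ) / n - ((j : ℝ) - 1) / n = 1 / n by ring,
        abs_of_pos (show 0 < 1 / (n : ℝ) by positivity)] at this
      calc _ ≤ n * (ε / 10 * (1 / n)) := by gcongr
        _ = ε / 10 := by field_simp
    · refine (hgδ ?_).le
      rw [Real.dist_eq, ← sub_div, abs_div, abs_of_pos hbn, div_lt_iff₀ hbn, abs_sub_comm]
      have h1 := hnear j x hx
      rw [show t - x - (t - (j : ℝ) / n) = (j : ℝ) / n - x by ring]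
      refine h1.trans_lt ?_
      rw [div_lt_iff₀ hδ] at hnbδ
      rw [div_lt_iff₀ hn]
      linarith
  · rw [intervalIntegral.integral_congr_ae (g := fun _ => 0)
      (Eventually.of_forall fun x hx => ?_)]
    · simp
    · have h1 := hnear j x hx
      have hz : ∀ y, b n < |t - y| → g ((t - y) / b n) = 0 := fun y hy =>
        eq_zero_of_one_lt_abs hs (by rwa [abs_div, abs_of_pos hbn, one_lt_div hbn])
      have h2 : |(j : ℝ) / n - t| ≤ |(j : ℝ) / n - x| + |t - x| := by
        rw [abs_sub_comm t x]; exact abs_sub_le _ _ _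
      rw [hz _ (by rw [abs_sub_comm]; linarith), hz x (by linarith), sub_zero]

/-- Averages of squares that are uniformly close to a rescaled kernel. -/
lemma tendsto_average_sq_of_uniform_approx {K : ℝ → ℝ} (hK : Continuous K)
    (hs : Function.support K ⊆ Icc (-1 : ℝ) 1) (ht0 : 0 < t) (ht1 : t < 1)
    (hb : ∀ n, 0 < b n) (hb0 : Tendsto b atTop (𝓝 0))
    (hnb : Tendsto (fun n : ℕ => (n : ℝ) * b n) atTop atTop) (A : ℕ → ℝ → ℝ) (c : ℝ)
    (hA : ∀ ε > 0, ∀ᶠ n in atTop, ∀ y ∈ Icc (0 : ℝ) 1, |A n y - c * K ((t - y) / b n)| ≤ ε)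
    (hA0 : ∀ᶠ n in atTop, ∀ y, 2 * b n < |y - t| → A n y = 0) :
    Tendsto (fun n : ℕ => 1 / (n * b n) * ∑ j ∈ Finset.Icc 1 n, A n ((j : ℝ) / n) ^ 2)
      atTop (𝓝 (c ^ 2 * ∫ x in Icc (-1 : ℝ) 1, K x ^ 2)) := by
  obtain ⟨B, hB0, hB⟩ := exists_pos_bound_of_support_subset_Icc hK hs
  have hR := (tendsto_riemann_sum_kernel (g := fun x => K x ^ 2) (by fun_prop)
    (fun x hx => hs fun h => hx (by simp [h])) ht0 ht1 hb hb0 hnb).const_mul (c ^ 2)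
  refine hR.congr_dist ?_
  rw [Metric.tendsto_nhds]
  intro ε hε
  set C := 1 + 2 * (|c| * B) with hC
  have hCpos : 0 < C := by positivity
  set η := min 1 (ε / (10 * C)) with hη
  have hηpos : 0 < η := by positivity
  filter_upwards [hA η hηpos, hA0, hnb.eventually_ge_atTop 1] with n h1 h2 h3
  have hbn := hb n
  rw [Real.dist_eq, sub_zero, abs_of_nonneg dist_nonneg, dist_comm, Real.dist_eq]
  rw [mul_left_comm, ← mul_sub, Finset.mul_sum, ← Finset.sum_sub_distrib]
  refine (abs_localized_average_le (t := t) (B := η * C) hbn h3 (by positivity) _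
    (fun j hj => ?_) fun j _ hj => ?_).trans_lt ?_
  · have hy : (j : ℝ) / n ∈ Icc (0 : ℝ) 1 :=
      ⟨by positivity, div_le_one_of_le₀ (by exact_mod_cast (Finset.mem_Icc.mp hj).2)
        (by positivity)⟩
    set p := A n ((j : ℝ) / n)
    set q := c * K ((t - (j : ℝ) / n) / b n) with hq
    have hpq : |p - q| ≤ η := h1 _ hy
    have hqB : |q| ≤ |c| * B := by
      rw [hq, abs_mul]; gcongr; exact hB _
    have hsum : |p + q| ≤ C := by
      calc |p + q| = |(p - q) + 2 * q| := by ring_nf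
        _ ≤ |p - q| + |2 * q| := abs_add_le _ _
        _ ≤ 1 + 2 * (|c| * B) := by
          rw [abs_mul, abs_two]
          linarith [min_le_left 1 (ε / (10 * C))]
    calc |p ^ 2 - c ^ 2 * K ((t - (j : ℝ) / n) / b n) ^ 2| = |p - q| * |p + q| := by
          rw [← abs_mul]; congr 1; rw [hq]; ring
      _ ≤ η * C := by gcongr
  · rw [h2 _ hj, eq_zero_of_one_lt_abs hs]
    · simp
    · rw [abs_div, abs_of_pos hbn, one_lt_div hbn, abs_sub_comm]
      linarith
  · have : η ≤ ε / (10 * C) := min_le_right _ _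
    rw [le_div_iff₀ (by positivity)] at this
    linarith

end Averages

section Root

variable {K : ℝ → ℝ} {t M : ℝ} {b ρ : ℕ → ℝ}

/-- A kernel of bandwidth `b` is asymptotically constant on windows of width `ρ = o(b)`. -/
lemma eventually_abs_integral_kernel_sub_le (hK : Continuous K)
    (hs : Function.support K ⊆ Icc (-1 : ℝ) 1) (hM : 0 < M)
    (hb : ∀ n, 0 < b n) (hρ : ∀ n, 0 < ρ n) (hρb : Tendsto (fun n => ρ n / b n) atTop (𝓝 0))
    (w : ℕ → ℝ → ℝ) {B c : ℝ} (hB0 : 0 < B) (hB : ∀ n x, |w n x| ≤ B)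
    (hw : ∀ᶠ n in atTop, ContinuousOn (w n) (Icc (t - M * ρ n) (t + M * ρ n)))
    (hlim : Tendsto (fun n => (ρ n)⁻¹ * ∫ x in Icc (t - M * ρ n) (t + M * ρ n), w n x)
      atTop (𝓝 c)) {ε : ℝ} (hε : 0 < ε) :
    ∀ᶠ n in atTop, ∀ y, |(ρ n)⁻¹ * (∫ x in Icc (t - M * ρ n) (t + M * ρ n),
      K ((x - y) / b n) * w n x) - c * K ((t - y) / b n)| ≤ ε := by
  obtain ⟨A, hA0, hA⟩ := exists_pos_bound_of_support_subset_Icc hK hs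
  have huc := (hasCompactSupport_of_support_subset_Icc hs).uniformContinuous_of_continuous hK
  obtain ⟨δ, hδ, hKδ⟩ := Metric.uniformContinuous_iff.mp huc (ε / (4 * M * B)) (by positivity)
  have hsmall : ∀ᶠ n in atTop, ρ n / b n < δ / M :=
    hρb.eventually_lt_const (by positivity)
  have hclose : ∀ᶠ n in atTop,
      |(ρ n)⁻¹ * (∫ x in Icc (t - M * ρ n) (t + M * ρ n), w n x) - c| < ε / (2 * A) :=
    (Metric.tendsto_nhds.mp hlim) (ε / (2 * A)) (by positivity)
  filter_upwards [hsmall, hclose, hw] with n h1 h2 hwn y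
  have hbn := hb n
  have hρn := hρ n
  set J := Icc (t - M * ρ n) (t + M * ρ n) with hJ
  have hint1 : IntegrableOn (fun x => K ((x - y) / b n) * w n x) J :=
    ContinuousOn.integrableOn_Icc ((Continuous.continuousOn (by fun_prop)).mul hwn)
  have hint2 : IntegrableOn (fun x => K ((t - y) / b n) * w n x) J :=
    ContinuousOn.integrableOn_Icc (continuousOn_const.mul hwn)
  have hsplit : (ρ n)⁻¹ * (∫ x in J, K ((x - y) / b n) * w n x) - c * K ((t - y) / b n) =
      (ρ n)⁻¹ * (∫ x in J, (K ((x - y) / b n) - K ((t - y) / b n)) * w n x) +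
        K ((t - y) / b n) * ((ρ n)⁻¹ * (∫ x in J, w n x) - c) := by
    simp_rw [sub_mul]
    rw [integral_sub hint1 hint2, integral_const_mul]
    ring
  have hfirst : |(ρ n)⁻¹ * (∫ x in J, (K ((x - y) / b n) - K ((t - y) / b n)) * w n x)|
      ≤ ε / 2 := by
    have hbd := norm_setIntegral_le_of_norm_le_const (μ := volume) (s := J)
      (f := fun x => (K ((x - y) / b n) - K ((t - y) / b n)) * w n x)
      (C := ε / (4 * M * B) * B) (by simp [hJ]) (fun x hx => ?_)
    · rw [hJ, Real.volume_real_Icc_of_le (by nlinarith), ← hJ, Real.norm_eq_abs] at hbd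
      rw [abs_mul, abs_of_pos (inv_pos.mpr hρn), inv_mul_le_iff₀ hρn]
      refine hbd.trans_eq ?_
      field_simp
      ring
    · rw [norm_mul]
      refine mul_le_mul (hKδ ?_).le (hB n x) (norm_nonneg _) (by positivity)
      rw [Real.dist_eq, ← sub_div, sub_sub_sub_cancel_right, abs_div, abs_of_pos hbn,
        div_lt_iff₀ hbn]
      rw [div_lt_div_iff₀ hbn hM] at h1
      have : |x - t| ≤ M * ρ n := abs_le.mpr ⟨by linarith [hx.1], by linarith [hx.2]⟩
      linarith
  have hsecond : |K ((t - y) / b n) * ((ρ n)⁻¹ * (∫ x in J, w n x) - c)| ≤ ε / 2 := by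
    rw [abs_mul]
    calc _ ≤ A * (ε / (2 * A)) := by gcongr; exact hA _
      _ = ε / 2 := by field_simp
  rw [hsplit]
  exact (abs_add_le _ _).trans (by linarith)

/-- Far from the root, the localized integral vanishes. -/
lemma integral_kernel_eq_zero_of_lt (hs : Function.support K ⊆ Icc (-1 : ℝ) 1)
    {r β y : ℝ} (hβ : 0 < β) (hr : r ≤ β) (w : ℝ → ℝ) (hy : 2 * β < |y - t|) :
    ∫ x in Icc (t - r) (t + r), K ((x - y) / β) * w x = 0 := by
  refine setIntegral_eq_zero_of_forall_eq_zero fun x hx => ?_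
  rw [eq_zero_of_one_lt_abs hs, zero_mul]
  rw [abs_div, abs_of_pos hβ, one_lt_div hβ]
  have h1 : |x - t| ≤ r := abs_le.mpr ⟨by linarith [hx.1], by linarith [hx.2]⟩
  have h2 : |y - t| ≤ |x - y| + |x - t| := by
    rw [abs_sub_comm x y]; exact abs_sub_le _ _ _
  linarith

/-- The contribution of a single root to the interior variance component. -/
lemma tendsto_average_sq_root (hK : Continuous K) (hs : Function.support K ⊆ Icc (-1 : ℝ) 1)
    (hM : 0 < M) (ht0 : 0 < t) (ht1 : t < 1)
    (hb : ∀ n, 0 < b n) (hb0 : Tendsto b atTop (𝓝 0))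
    (hnb : Tendsto (fun n : ℕ => (n : ℝ) * b n) atTop atTop)
    (hρ : ∀ n, 0 < ρ n) (hρb : Tendsto (fun n => ρ n / b n) atTop (𝓝 0))
    {σ : ℝ → ℝ} {L : NNReal} (hσ : LipschitzOnWith L σ (Icc 0 1))
    (w : ℕ → ℝ → ℝ) {B c : ℝ} (hB0 : 0 < B) (hB : ∀ n x, |w n x| ≤ B)
    (hw : ∀ᶠ n in atTop, ContinuousOn (w n) (Icc (t - M * ρ n) (t + M * ρ n)))
    (hlim : Tendsto (fun n => (ρ n)⁻¹ * ∫ x in Icc (t - M * ρ n) (t + M * ρ n), w n x)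
      atTop (𝓝 c)) :
    Tendsto (fun n : ℕ => 1 / (n * b n) * ∑ j ∈ Finset.Icc 1 n, (σ ((j : ℝ) / n) *
        ((ρ n)⁻¹ * ∫ x in Icc (t - M * ρ n) (t + M * ρ n),
          K ((x - (j : ℝ) / n) / b n) * w n x)) ^ 2)
      atTop (𝓝 ((σ t * c) ^ 2 * ∫ x in Icc (-1 : ℝ) 1, K x ^ 2)) := by
  obtain ⟨A, hA0, hA⟩ := exists_pos_bound_of_support_subset_Icc hK hs
  have hfar : ∀ᶠ n in atTop, ∀ y, 2 * b n < |y - t| → σ y * ((ρ n)⁻¹ *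
      ∫ x in Icc (t - M * ρ n) (t + M * ρ n), K ((x - y) / b n) * w n x) = 0 := by
    filter_upwards [hρb.eventually_lt_const (show 0 < 1 / M by positivity)] with n hn y hy
    rw [div_lt_div_iff₀ (hb n) hM] at hn
    rw [integral_kernel_eq_zero_of_lt hs (hb n) (by linarith) _ hy]
    simp
  refine tendsto_average_sq_of_uniform_approx hK hs ht0 ht1 hb hb0 hnb
    (fun n y => σ y * ((ρ n)⁻¹ * ∫ x in Icc (t - M * ρ n) (t + M * ρ n),
      K ((x - y) / b n) * w n x)) (σ t * c) (fun ε hε => ?_) hfar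
  have htmem : t ∈ Icc (0 : ℝ) 1 := ⟨ht0.le, ht1.le⟩
  set S := |σ t| + L with hS
  have hlip : ∀ y ∈ Icc (0 : ℝ) 1, |σ y - σ t| ≤ L * |y - t| := fun y hy =>
    hσ.dist_le_mul y hy t htmem
  have hσS : ∀ y ∈ Icc (0 : ℝ) 1, |σ y| ≤ S := by
    intro y hy
    have h1 : |y - t| ≤ 1 := abs_le.mpr ⟨by linarith [hy.1], by linarith [hy.2]⟩
    have h2 := abs_sub_abs_le_abs_sub (σ y) (σ t)
    have h3 := hlip y hy
    have h4 : (L : ℝ) * |y - t| ≤ L := mul_le_of_le_one_right L.2 h1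
    linarith
  have hS0 : 0 ≤ S := (abs_nonneg _).trans (hσS t htmem)
  have hη : 0 < ε / (2 * (S + 1)) := by positivity
  have hbsmall : ∀ᶠ n in atTop, L * (2 * b n) * (|c| * A) < ε / 2 := by
    have : Tendsto (fun n => L * (2 * b n) * (|c| * A)) atTop (𝓝 0) := by
      simpa using ((hb0.const_mul 2).const_mul (L : ℝ)).mul_const (|c| * A)
    exact this.eventually_lt_const (by positivity)
  filter_upwards [hbsmall, hfar, eventually_abs_integral_kernel_sub_le hK hs hM hb hρ hρb w hB0
    hB hw hlim hη] with n h1 h2 h3 y hy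
  by_cases hyt : 2 * b n < |y - t|
  · rw [h2 y hyt, eq_zero_of_one_lt_abs hs]
    · simpa using hε.le
    · rw [abs_div, abs_of_pos (hb n), one_lt_div (hb n), abs_sub_comm]
      linarith [hb n]
  · push Not at hyt
    set F := (ρ n)⁻¹ * ∫ x in Icc (t - M * ρ n) (t + M * ρ n), K ((x - y) / b n) * w n x
    set k := K ((t - y) / b n)
    have e1 : |σ y| * |F - c * k| ≤ ε / 2 := by
      calc |σ y| * |F - c * k| ≤ (S + 1) * (ε / (2 * (S + 1))) := by
            gcongr
            · linarith [hσS y hy]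
            · exact h3 y
        _ = ε / 2 := by field_simp
    have hbn := hb n
    have e2 : |σ y - σ t| * (|c| * |k|) ≤ ε / 2 := by
      calc |σ y - σ t| * (|c| * |k|) ≤ L * (2 * b n) * (|c| * A) := by
            gcongr
            · exact (hlip y hy).trans (by gcongr)
            · exact hA _
        _ ≤ ε / 2 := h1.le
    calc |σ y * F - σ t * c * k| = |σ y * (F - c * k) + (σ y - σ t) * (c * k)| := by ring_nf
      _ ≤ |σ y * (F - c * k)| + |(σ y - σ t) * (c * k)| := abs_add_le _ _
      _ ≤ ε := by rw [abs_mul, abs_mul, abs_mul c]; linarith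

end Root

section CriticalRootStructure

variable {μ : ℝ → ℝ} {m γ : ℝ} {k : ℕ} {t : ℕ → ℝ} {v : ℕ → ℕ}

namespace CriticalRootStructure

lemma extRoots_succ_sub_pos (H : CriticalRootStructure μ m k t v γ) {i : ℕ} (hi : i ≤ k) :
    0 < extRoots k t (i + 1) - extRoots k t i := by
  have hk := H.k_pos
  have h1 := H.first_pos
  have h2 := H.last_lt
  rcases Nat.eq_zero_or_pos i with rfl | hi0
  · simpa [extRoots, Nat.succ_le_iff.mpr hk] using h1
  · rcases hi.lt_or_eq with hlt | rfl
    · simpa [extRoots, hi0.ne', hi, Nat.succ_le_iff.mpr hlt] using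
        H.mono i (i + 1) hi0 (Nat.lt_succ_self i) hlt
    · simpa [extRoots, hi0.ne'] using h2

lemma gamma_pos (H : CriticalRootStructure μ m k t v γ) : 0 < γ := by
  rw [H.gamma_eq]
  refine mul_pos (by norm_num) ((Finset.lt_inf'_iff _).mpr fun i hi => ?_)
  exact H.extRoots_succ_sub_pos (Finset.mem_Icc.mp hi).2

lemma two_mul_gamma_le_succ_sub (H : CriticalRootStructure μ m k t v γ) {i : ℕ} (hi : i ≤ k) :
    2 * γ ≤ extRoots k t (i + 1) - extRoots k t i := by
  have := Finset.inf'_le (fun i => extRoots k t (i + 1) - extRoots k t i)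
    (Finset.mem_Icc.mpr ⟨Nat.zero_le i, hi⟩)
  rw [H.gamma_eq]
  linarith

lemma two_mul_gamma_le_sub (H : CriticalRootStructure μ m k t v γ) {i j : ℕ} (hij : i < j)
    (hj : j ≤ k + 1) : 2 * γ ≤ extRoots k t j - extRoots k t i := by
  induction j, hij using Nat.le_induction with
  | base => exact H.two_mul_gamma_le_succ_sub (by omega)
  | succ j hij ih =>
    have h1 := ih (by omega)
    have h2 := H.extRoots_succ_sub_pos (i := j) (by omega)
    linarith

lemma extRoots_eq {l : ℕ} (hl : l ∈ Finset.Icc 1 k) : extRoots k t l = t l := by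
  rw [Finset.mem_Icc] at hl
  simp [extRoots, hl.2, show l ≠ 0 by omega]

lemma two_mul_gamma_le_root (H : CriticalRootStructure μ m k t v γ) {l : ℕ}
    (hl : l ∈ Finset.Icc 1 k) : 2 * γ ≤ t l := by
  have h := Finset.mem_Icc.mp hl
  have := H.two_mul_gamma_le_sub (i := 0) (j := l) (by omega) (by omega)
  rw [extRoots_eq hl] at this
  simpa [extRoots] using this

lemma root_add_two_mul_gamma_le (H : CriticalRootStructure μ m k t v γ) {l : ℕ}
    (hl : l ∈ Finset.Icc 1 k) : t l + 2 * γ ≤ 1 := by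
  have h := Finset.mem_Icc.mp hl
  have := H.two_mul_gamma_le_sub (i := l) (j := k + 1) (by omega) le_rfl
  rw [extRoots_eq hl, show extRoots k t (k + 1) = 1 by simp [extRoots]] at this
  linarith

lemma two_mul_gamma_le_abs_sub (H : CriticalRootStructure μ m k t v γ) {i j : ℕ}
    (hi : i ∈ Finset.Icc 1 k) (hj : j ∈ Finset.Icc 1 k) (hij : i ≠ j) :
    2 * γ ≤ |t i - t j| := by
  have hi' := Finset.mem_Icc.mp hi
  have hj' := Finset.mem_Icc.mp hj
  rcases lt_or_gt_of_ne hij with h | h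
  · have := H.two_mul_gamma_le_sub h (by omega)
    rw [extRoots_eq hi, extRoots_eq hj] at this
    rw [abs_sub_comm]
    exact this.trans (le_abs_self _)
  · have := H.two_mul_gamma_le_sub h (by omega)
    rw [extRoots_eq hi, extRoots_eq hj] at this
    exact this.trans (le_abs_self _)

lemma contDiffOn (H : CriticalRootStructure μ m k t v γ) {l : ℕ} (hl : l ∈ Finset.Icc 1 k) :
    ContDiffOn ℝ (v l + 1 : ℕ) μ (Icc (t l - γ) (t l + γ)) := by
  obtain ⟨h1, h2⟩ := Finset.mem_Icc.mp hl
  have hγ := H.gamma_pos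
  rw [contDiffOn_nat_iff_continuousOn_differentiableOn_deriv
    (uniqueDiffOn_Icc (by linarith))]
  refine ⟨fun j hj => ?_, fun j hj => H.diffble l h1 h2 j (by omega)⟩
  rcases hj.lt_or_eq with h | rfl
  · exact (H.diffble l h1 h2 j (by omega)).continuousOn
  · obtain ⟨C, hC⟩ := H.deriv_lip l h1 h2
    exact hC.continuousOn

lemma ne_of_ne_root (H : CriticalRootStructure μ m k t v γ) {l : ℕ} (hl : l ∈ Finset.Icc 1 k)
    {x : ℝ} (hx : x ∈ Icc (t l - γ) (t l + γ)) (hxt : x ≠ t l) : μ x ≠ m := by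
  obtain ⟨h1, h2⟩ := Finset.mem_Icc.mp hl
  have hγ := H.gamma_pos
  rw [← H.root l h1 h2]
  rcases lt_or_gt_of_ne hxt with h | h
  · have hinj : InjOn μ (Icc (t l - γ) (t l)) :=
      (H.mono_left l h1 h2).elim StrictMonoOn.injOn StrictAntiOn.injOn
    exact fun he => hxt (hinj ⟨hx.1, h.le⟩ ⟨by linarith, le_rfl⟩ he)
  · have hinj : InjOn μ (Icc (t l) (t l + γ)) :=
      (H.mono_right l h1 h2).elim StrictMonoOn.injOn StrictAntiOn.injOn
    exact fun he => hxt (hinj ⟨h.le, hx.2⟩ ⟨le_rfl, by linarith⟩ he)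

/-- The leading Taylor coefficient of `μ` at the root `t l`. -/
noncomputable def leadingCoeff (μ : ℝ → ℝ) (t : ℕ → ℝ) (v : ℕ → ℕ) (γ : ℝ) (l : ℕ) : ℝ :=
  iteratedDerivWithin (v l + 1) μ (Icc (t l - γ) (t l + γ)) (t l) / (v l + 1).factorial

lemma leadingCoeff_ne_zero (H : CriticalRootStructure μ m k t v γ) {l : ℕ}
    (hl : l ∈ Finset.Icc 1 k) : leadingCoeff μ t v γ l ≠ 0 := by
  obtain ⟨h1, h2⟩ := Finset.mem_Icc.mp hl
  exact div_ne_zero (H.deriv_ne l h1 h2) (by positivity)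

lemma tendsto_leadingCoeff (H : CriticalRootStructure μ m k t v γ) {l : ℕ}
    (hl : l ∈ Finset.Icc 1 k) :
    Tendsto (fun x => (μ x - m) / (x - t l) ^ (v l + 1)) (𝓝[≠] t l)
      (𝓝 (leadingCoeff μ t v γ l)) := by
  obtain ⟨h1, h2⟩ := Finset.mem_Icc.mp hl
  exact tendsto_sub_div_pow_of_iteratedDerivWithin_eq_zero H.gamma_pos (H.contDiffOn hl)
    (H.root l h1 h2) (H.deriv_zero l h1 h2)

/-- A radius, on the scale `ρ = h ^ (1/V)`, outside of which the localizing kernel vanishes. -/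
lemma exists_radius (H : CriticalRootStructure μ m k t v γ) {K : ℝ → ℝ}
    (hs : Function.support K ⊆ Icc (-1 : ℝ) 1) {l V : ℕ} (hl : l ∈ Finset.Icc 1 k)
    (hV : v l + 1 ≤ V) :
    ∃ M : ℝ, 1 ≤ M ∧ 1 < |leadingCoeff μ t v γ l| * M ∧ ∀ ρ, 0 < ρ → ρ ≤ 1 →
      ∀ x ∈ Icc (t l - γ) (t l + γ), M * ρ < |x - t l| → K ((μ x - m) / ρ ^ V) = 0 := by
  have ha := H.leadingCoeff_ne_zero hl
  obtain ⟨κ, hκ, hlow⟩ := exists_mul_pow_le_abs_sub H.gamma_pos (H.contDiffOn hl).continuousOn ha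
    (fun x hx => H.ne_of_ne_root hl hx) (H.tendsto_leadingCoeff hl)
  have hapos := abs_pos.mpr ha
  refine ⟨1 + 1 / κ + 1 / |leadingCoeff μ t v γ l|, ?_, ?_, fun ρ hρ hρ1 x hx hfar => ?_⟩
  · have : 0 < 1 / κ + 1 / |leadingCoeff μ t v γ l| := by positivity
    linarith
  · have : 0 < |leadingCoeff μ t v γ l| * (1 / κ) := by positivity
    rw [mul_add, mul_one_div_cancel hapos.ne', mul_add]
    linarith
  · refine kernel_eq_zero_of_lt_abs_sub hs (Nat.succ_pos _) hV hκ ?_ ?_ hρ hρ1 (hlow x hx) hfar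
    · have : 0 < 1 / κ + 1 / |leadingCoeff μ t v γ l| := by positivity
      linarith
    · have : 0 < κ * (1 / |leadingCoeff μ t v γ l|) := by positivity
      rw [mul_add, mul_add, mul_one_div_cancel hκ.ne']
      linarith

/-- For a small scale `ρ`, the integral over `[0, 1]` splits over disjoint windows at the roots. -/
lemma integral_eq_sum (H : CriticalRootStructure μ m k t v γ) {f W : ℝ → ℝ} (hf : Continuous f)
    {r : ℕ → ℝ} (hr : ∀ l ∈ Finset.Icc 1 k, r l < γ)
    (hW : ∀ l ∈ Finset.Icc 1 k, ContinuousOn W (Icc (t l - γ) (t l + γ)))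
    (hW0 : ∀ x ∈ Icc (0 : ℝ) 1, (∀ l ∈ Finset.Icc 1 k, r l < |x - t l|) → W x = 0) :
    ∫ x in Icc (0 : ℝ) 1, f x * W x =
      ∑ l ∈ Finset.Icc 1 k, ∫ x in Icc (t l - r l) (t l + r l), f x * W x := by
  have hγ := H.gamma_pos
  rw [← integral_biUnion_finset _ (fun l _ => measurableSet_Icc)]
  · refine setIntegral_eq_of_subset_of_forall_sdiff_eq_zero measurableSet_Icc ?_ fun x hx => ?_
    · refine iUnion₂_subset fun l hl x hx => ?_
      have h1 := H.two_mul_gamma_le_root hl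
      have h2 := H.root_add_two_mul_gamma_le hl
      have h3 := hr l hl
      exact ⟨by linarith [hx.1], by linarith [hx.2]⟩
    · rw [hW0 x hx.1 fun l hl => ?_, mul_zero]
      by_contra! h
      refine hx.2 (mem_biUnion hl ?_)
      rw [abs_le] at h
      exact ⟨by linarith [h.1], by linarith [h.2]⟩
  · intro i hi j hj hij
    refine Set.disjoint_left.mpr fun x hxi hxj => ?_
    have h1 := H.two_mul_gamma_le_abs_sub hi hj hij
    have h2 : |x - t i| ≤ r i := abs_le.mpr ⟨by linarith [hxi.1], by linarith [hxi.2]⟩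
    have h3 : |x - t j| ≤ r j := abs_le.mpr ⟨by linarith [hxj.1], by linarith [hxj.2]⟩
    have h4 := abs_sub_le (t i) x (t j)
    rw [abs_sub_comm (t i) x] at h4
    linarith [hr i hi, hr j hj]
  · intro l hl
    have h3 := hr l hl
    refine ContinuousOn.integrableOn_Icc (hf.continuousOn.mul ((hW l hl).mono ?_))
    exact Icc_subset_Icc (by linarith) (by linarith)

end CriticalRootStructure

lemma sq_sum_eq_sum_sq_of_mul_eq_zero {ι : Type*} (s : Finset ι) (f : ι → ℝ)
    (h : ∀ i ∈ s, ∀ j ∈ s, i ≠ j → f i * f j = 0) : (∑ i ∈ s, f i) ^ 2 = ∑ i ∈ s, f i ^ 2 := by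
  rw [sq, Finset.sum_mul_sum]
  refine Finset.sum_congr rfl fun i hi => ?_
  rw [Finset.sum_eq_single_of_mem i hi fun j hj hij => h i hi j hj hij.symm, sq]

end CriticalRootStructure

lemma inv_rpow_one_div_sq_eq {D f : ℝ} (hf : 0 < f) {V : ℕ} :
    ((|D / f| ^ (1 / (V : ℝ)))⁻¹) ^ 2 = f ^ ((2 : ℝ) / V) / |D| ^ ((2 : ℝ) / V) := by
  have hsq : (|D / f| ^ (1 / (V : ℝ))) ^ 2 = |D / f| ^ ((2 : ℝ) / V) := by
    rw [← Real.rpow_mul_natCast (abs_nonneg _)]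
    congr 1
    push_cast
    ring
  rw [inv_pow, hsq, abs_div, abs_of_pos hf, Real.div_rpow (abs_nonneg _) hf.le, inv_div]

/-- assertion (B.1) in the regime `b_n^{v+1}/h_n → ∞`: limit of the
interior variance component `α_n` of the Gaussian approximation. -/
theorem interior_variance_component_limit
    (μ : ℝ → ℝ) (m : ℝ) (k : ℕ) (t : ℕ → ℝ) (v : ℕ → ℕ) (γ : ℝ)
    (hcrs : CriticalRootStructure μ m k t v γ)
    (σ : ℝ → ℝ) (hσ : ∃ L : NNReal, LipschitzOnWith L σ (Icc 0 1))
    (K : ℝ → ℝ) (hKc : Continuous K) (hKe : ∀ x, K (-x) = K x)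
    (hKs : Function.support K ⊆ Icc (-1 : ℝ) 1)
    (K_d : ℝ → ℝ) (hKdc : Continuous K_d) (hKde : ∀ x, K_d (-x) = K_d x)
    (hKds : Function.support K_d ⊆ Icc (-1 : ℝ) 1)
    (b h : ℕ → ℝ) (hbpos : ∀ n, 0 < b n) (hhpos : ∀ n, 0 < h n)
    (hb0 : Tendsto b atTop (𝓝 0))
    (hnb : Tendsto (fun n : ℕ => (n:ℝ) * b n) atTop atTop)
    (hh0 : Tendsto h atTop (𝓝 0))
    (hbh : Tendsto (fun n : ℕ => (b n) ^ ((Finset.Icc 1 k).sup v + 1) / h n) atTop atTop) :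
    Tendsto (fun n : ℕ =>
        (n:ℝ) * b n *
          (h n) ^ ((2 * (((Finset.Icc 1 k).sup v : ℕ) : ℝ)) /
            ((((Finset.Icc 1 k).sup v : ℕ) : ℝ) + 1)) *
        ((1 / ((n:ℝ)^2 * (b n)^2 * (h n)^2)) *
          ∑ j ∈ Finset.Icc 1 n,
            (∫ x in Icc (0:ℝ) 1,
              σ ((j:ℝ) / (n:ℝ)) * K ((x - (j:ℝ) / (n:ℝ)) / b n) *
                K_d ((μ x - m) / h n))^2))
      atTop
      (𝓝 ((Nat.factorial ((Finset.Icc 1 k).sup v + 1) : ℝ) ^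
          ((2:ℝ) / ((((Finset.Icc 1 k).sup v : ℕ) : ℝ) + 1)) *
        (∫ z in Icc (-1 : ℝ) 1, K_d (z ^ ((Finset.Icc 1 k).sup v + 1)))^2 *
        (∫ x in Icc (-1 : ℝ) 1, (K x)^2) *
        ∑ l ∈ (Finset.Icc 1 k).filter (fun l => v l = (Finset.Icc 1 k).sup v),
          (σ (t l))^2 /
            |iteratedDerivWithin (v l + 1) μ (Icc (t l - γ) (t l + γ)) (t l)| ^
              ((2:ℝ) / ((((Finset.Icc 1 k).sup v : ℕ) : ℝ) + 1)))) := by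
  obtain ⟨L, hσ⟩ := hσ
  obtain ⟨B, hB0, hB⟩ := exists_pos_bound_of_support_subset_Icc hKdc hKds
  set w : ℕ := (Finset.Icc 1 k).sup v
  set ρ : ℕ → ℝ := fun n => h n ^ (1 / ((w + 1 : ℕ) : ℝ)) with hρdef
  have hγ := hcrs.gamma_pos
  have hρ : ∀ n, 0 < ρ n := fun n => Real.rpow_pos_of_pos (hhpos n) _
  have hρV : ∀ n, ρ n ^ (w + 1) = h n := fun n => by
    rw [hρdef, one_div]
    exact Real.rpow_inv_natCast_pow (hhpos n).le (Nat.succ_ne_zero w)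
  have hρ0 : Tendsto ρ atTop (𝓝 0) := by
    have hpos : (0 : ℝ) < 1 / ((w + 1 : ℕ) : ℝ) := by positivity
    have := hh0.rpow_const (p := 1 / ((w + 1 : ℕ) : ℝ)) (Or.inr hpos.le)
    rwa [Real.zero_rpow hpos.ne'] at this
  have hρb : Tendsto (fun n => ρ n / b n) atTop (𝓝 0) := by
    have hpow : Tendsto (fun n => (ρ n / b n) ^ (w + 1)) atTop (𝓝 0) := by
      refine hbh.inv_tendsto_atTop.congr fun n => ?_
      rw [Pi.inv_apply, inv_div, div_pow, hρV]
    rw [Metric.tendsto_nhds] at hpow ⊢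
    intro ε hε
    filter_upwards [hpow (ε ^ (w + 1)) (by positivity)] with n hn
    have hr : 0 < ρ n / b n := div_pos (hρ n) (hbpos n)
    rw [Real.dist_eq, sub_zero, abs_of_pos (by positivity)] at hn ⊢
    exact lt_of_pow_lt_pow_left₀ _ hε.le hn
  have hvw : ∀ l ∈ Finset.Icc 1 k, v l + 1 ≤ w + 1 := fun l hl =>
    Nat.succ_le_succ (Finset.le_sup (f := v) hl)
  have hrad : ∀ l, ∃ M : ℝ, l ∈ Finset.Icc 1 k → 1 ≤ M ∧
      1 < |CriticalRootStructure.leadingCoeff μ t v γ l| * M ∧ ∀ ρ, 0 < ρ → ρ ≤ 1 →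
      ∀ x ∈ Icc (t l - γ) (t l + γ), M * ρ < |x - t l| → K_d ((μ x - m) / ρ ^ (w + 1)) = 0 := by
    intro l
    by_cases hl : l ∈ Finset.Icc 1 k
    · obtain ⟨M, hM⟩ := hcrs.exists_radius hKds hl (hvw l hl)
      exact ⟨M, fun _ => hM⟩
    · exact ⟨0, fun h => absurd h hl⟩
  choose M hM using hrad
  have hMpos : ∀ l ∈ Finset.Icc 1 k, 0 < M l := fun l hl => by linarith [(hM l hl).1]
  have hWc : ∀ n, ∀ l ∈ Finset.Icc 1 k,
      ContinuousOn (fun x => K_d ((μ x - m) / ρ n ^ (w + 1))) (Icc (t l - γ) (t l + γ)) :=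
    fun n l hl => hKdc.comp_continuousOn
      (((hcrs.contDiffOn hl).continuousOn.sub continuousOn_const).div_const _)
  have hMρ : ∀ l ∈ Finset.Icc 1 k, ∀ᶠ n in atTop, M l * ρ n < γ := fun l _ => by
    have : Tendsto (fun n => M l * ρ n) atTop (𝓝 0) := by simpa using hρ0.const_mul (M l)
    exact this.eventually_lt_const hγ
  have hMb : ∀ l ∈ Finset.Icc 1 k, ∀ᶠ n in atTop, M l * ρ n ≤ b n := fun l hl => by
    filter_upwards [hρb.eventually_lt_const (one_div_pos.mpr (hMpos l hl))] with n hn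
    rw [div_lt_div_iff₀ (hbpos n) (hMpos l hl)] at hn
    linarith
  have hroot : ∀ l ∈ Finset.Icc 1 k, _ := fun l hl =>
    tendsto_average_sq_root hKc hKs (hMpos l hl)
      (by linarith [hcrs.two_mul_gamma_le_root hl])
      (by linarith [hcrs.root_add_two_mul_gamma_le hl])
      hbpos hb0 hnb hρ hρb hσ (fun n x => K_d ((μ x - m) / ρ n ^ (w + 1))) hB0
      (fun n x => hB _)
      (by
        filter_upwards [hMρ l hl] with n hn
        exact (hWc n l hl).mono (Icc_subset_Icc (by linarith) (by linarith)))
      (tendsto_inv_mul_integral_kernel hKdc hKds hγ (hvw l hl) (hcrs.contDiffOn hl).continuousOn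
        (hcrs.leadingCoeff_ne_zero hl) (hcrs.tendsto_leadingCoeff hl) (hMpos l hl) hρ hρ0)
  have hsum := tendsto_finsetSum _ hroot
  have hconst : ∀ l ∈ Finset.Icc 1 k, (σ (t l) * (if v l + 1 = w + 1 then
      ∫ z in (-M l)..M l, K_d (CriticalRootStructure.leadingCoeff μ t v γ l * z ^ (w + 1))
      else 0)) ^ 2 * (∫ x in Icc (-1 : ℝ) 1, K x ^ 2) =
      if v l = w then ((w + 1).factorial : ℝ) ^ ((2 : ℝ) / ((w : ℝ) + 1)) *
        (∫ z in Icc (-1 : ℝ) 1, K_d (z ^ (w + 1))) ^ 2 * (∫ x in Icc (-1 : ℝ) 1, K x ^ 2) *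
        (σ (t l) ^ 2 / |iteratedDerivWithin (v l + 1) μ (Icc (t l - γ) (t l + γ)) (t l)| ^
          ((2 : ℝ) / ((w : ℝ) + 1))) else 0 := by
    intro l hl
    by_cases hvl : v l = w
    · rw [if_pos (by rw [hvl]), if_pos hvl, integral_comp_const_mul_pow hKde hKds
        (Nat.succ_pos w) (hcrs.leadingCoeff_ne_zero hl) (hM l hl).1 (hM l hl).2.1]
      rw [mul_pow, mul_pow, CriticalRootStructure.leadingCoeff,
        inv_rpow_one_div_sq_eq (by positivity)]
      rw [hvl]
      push_cast
      ring
    · rw [if_neg (by omega), if_neg hvl]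
      simp
  rw [Finset.sum_congr rfl hconst, ← Finset.sum_filter, ← Finset.mul_sum] at hsum
  refine hsum.congr' ?_
  obtain ⟨ε₀, hε₀, hsep⟩ := hcrs.sep
  filter_upwards [hh0.eventually_lt_const hε₀, hρ0.eventually_lt_const one_pos,
    hb0.eventually_lt_const (half_pos hγ), hnb.eventually_ge_atTop 1,
    (Finset.eventually_all _).mpr hMρ, (Finset.eventually_all _).mpr hMb]
    with n hhn hρ1 hbγ hnb1 hMρn hMbn
  have hbn := hbpos n
  have hρn := hρ n
  have hn0 : (n : ℝ) ≠ 0 := by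
    intro h
    rw [h, zero_mul] at hnb1
    linarith
  have hfar : ∀ x ∈ Icc (0 : ℝ) 1, (∀ l ∈ Finset.Icc 1 k, M l * ρ n < |x - t l|) →
      K_d ((μ x - m) / ρ n ^ (w + 1)) = 0 := by
    intro x hx hxl
    by_cases hin : ∃ l ∈ Finset.Icc 1 k, |x - t l| ≤ γ
    · obtain ⟨l, hl, hlx⟩ := hin
      rw [abs_le] at hlx
      exact (hM l hl).2.2 (ρ n) hρn hρ1.le x ⟨by linarith [hlx.1], by linarith [hlx.2]⟩ (hxl l hl)
    · push Not at hin
      have := hsep x hx fun l h1 h2 => hin l (Finset.mem_Icc.mpr ⟨h1, h2⟩)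
      refine eq_zero_of_one_lt_abs hKds ?_
      rw [hρV, abs_div, abs_of_pos (hhpos n), one_lt_div (hhpos n)]
      linarith
  have hterm : ∀ y : ℝ, (∫ x in Icc (0 : ℝ) 1,
      σ y * K ((x - y) / b n) * K_d ((μ x - m) / h n)) ^ 2 =
      ρ n ^ 2 * ∑ l ∈ Finset.Icc 1 k, (σ y * ((ρ n)⁻¹ *
        ∫ x in Icc (t l - M l * ρ n) (t l + M l * ρ n),
          K ((x - y) / b n) * K_d ((μ x - m) / ρ n ^ (w + 1)))) ^ 2 := by
    intro y
    rw [← sq_sum_eq_sum_sq_of_mul_eq_zero, ← Finset.mul_sum, ← Finset.mul_sum,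
      ← hcrs.integral_eq_sum (by fun_prop) hMρn (hWc n) hfar]
    · simp_rw [mul_assoc, hρV]
      rw [integral_const_mul]
      field_simp
    · intro i hi j hj hij
      have hsepij := hcrs.two_mul_gamma_le_abs_sub hi hj hij
      have htri := abs_sub_le (t i) y (t j)
      rw [abs_sub_comm (t i) y] at htri
      by_cases hyi : 2 * b n < |y - t i|
      · rw [integral_kernel_eq_zero_of_lt hKs hbn (hMbn i hi) _ hyi]
        simp
      · rw [integral_kernel_eq_zero_of_lt hKs hbn (hMbn j hj)
          (fun x => K_d ((μ x - m) / ρ n ^ (w + 1))) (show 2 * b n < |y - t j| by linarith)]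
        simp
  have hpre : h n ^ ((2 * (w : ℝ)) / ((w : ℝ) + 1)) = ρ n ^ (2 * w) := by
    rw [hρdef]
    simp only
    rw [← Real.rpow_mul_natCast (hhpos n).le]
    congr 1
    push_cast
    ring
  rw [hpre, Finset.sum_congr rfl fun (j : ℕ) _ => hterm ((j : ℝ) / n), ← Finset.mul_sum,
    Finset.sum_comm, ← Finset.mul_sum,
    show h n ^ 2 = ρ n ^ (2 * w) * ρ n ^ 2 by rw [← hρV]; ring]
  have hcancel : ∀ T : ℝ, 1 / (n * b n) * T = n * b n * ρ n ^ (2 * w) *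
      (1 / (n ^ 2 * b n ^ 2 * (ρ n ^ (2 * w) * ρ n ^ 2)) * (ρ n ^ 2 * T)) := fun T => by
    field_simp
  exact hcancel _
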